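/- arXiv:2102.08379 — 3 statements merged into one kernel-verified Lean document; each statement's English description precedes it below -/
import Mathlib

section
/- Let n ≥ 3 and let a₁, a₂, …, aₙ be distinct nonzero square-free integers, none equal to 1. Suppose that (1) there exists a subset T ⊆ {1, …, n} of odd cardinality such that (a) the product ∏_{j∈T} aⱼ is a perfect square, and (b) for every j ∈ T and every odd prime p dividing aⱼ, there exists i ∈ {1, …, n} with i ≠ j such that the Legendre symbol (aᵢ/p) = +1; and (2) some aᵢ equals 8m + 1 for some nonzero integer m. Then the polynomial f(x) = (x² − a₁)(x² − a₂)⋯(x² − aₙ) has a root modulo every positive integer. -/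
/-- An integer polynomial with a root modulo every prime power has a root modulo every
positive integer. -/
theorem Polynomial.exists_dvd_eval_of_prime_pow (f : Polynomial ℤ)
    (h : ∀ p k : ℕ, p.Prime → ∃ x : ℤ, ((p ^ k : ℕ) : ℤ) ∣ f.eval x) (m : ℕ) (hm : 0 < m) :
    ∃ x : ℤ, (m : ℤ) ∣ f.eval x := by
  induction m using Nat.recOnPrimeCoprime with
  | zero => exact absurd hm (lt_irrefl 0)
  | prime_pow p k hp => exact h p k hp
  | coprime a b ha hb hab iha ihb =>
    obtain ⟨x, hx⟩ := iha (by omega)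
    obtain ⟨y, hy⟩ := ihb (by omega)
    have hab' : IsCoprime (a : ℤ) b := Nat.isCoprime_iff_coprime.2 hab
    obtain ⟨u, v, huv⟩ := hab'
    have key : ∀ (d w z : ℤ), d ∣ z - w → d ∣ f.eval w → d ∣ f.eval z := fun d w z hzw hw ↦
      (dvd_iff_dvd_of_dvd_sub (hzw.trans (Polynomial.sub_dvd_eval_sub z w f))).2 hw
    refine ⟨x * (v * b) + y * (u * a), ?_⟩
    rw [Nat.cast_mul]
    refine IsCoprime.mul_dvd ⟨u, v, huv⟩ (key _ x _ ⟨u * (y - x), ?_⟩ hx)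
      (key _ y _ ⟨v * (x - y), ?_⟩ hy)
    · linear_combination x * huv
    · linear_combination y * huv

/-- Hensel lifting of square roots at an odd prime. -/
theorem Int.exists_pow_dvd_sq_sub_of_odd_prime {p : ℕ} (hp : p.Prime) (hp2 : p ≠ 2) {a : ℤ}
    (hpa : ¬ (p : ℤ) ∣ a) {x₀ : ℤ} (hx₀ : (p : ℤ) ∣ x₀ ^ 2 - a) (k : ℕ) :
    ∃ x : ℤ, (p : ℤ) ^ (k + 1) ∣ x ^ 2 - a := by
  induction k with
  | zero => exact ⟨x₀, by simpa using hx₀⟩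
  | succ k ih =>
    obtain ⟨x, c, hc⟩ := ih
    have hpi : Prime (p : ℤ) := Nat.prime_iff_prime_int.1 hp
    have hpx : ¬ (p : ℤ) ∣ 2 * x := by
      intro h
      rcases hpi.dvd_or_dvd h with h | h
      · exact hp2 ((Nat.prime_dvd_prime_iff_eq hp Nat.prime_two).1 (by exact_mod_cast h))
      · refine hpa ?_
        have h' : (p : ℤ) ∣ x ^ 2 - a := hc ▸ (dvd_pow_self _ k.succ_ne_zero).mul_right c
        exact (dvd_sub_right (dvd_pow h two_ne_zero)).1 h'
    obtain ⟨u, v, huv⟩ := (hpi.coprime_iff_not_dvd).2 hpx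
    refine ⟨x - (p : ℤ) ^ (k + 1) * (v * c), c * u + (p : ℤ) ^ k * (v * c) ^ 2, ?_⟩
    linear_combination hc - (p : ℤ) ^ (k + 1) * c * huv

/-- An integer congruent to `1` modulo `8` is a square modulo every power of `2`. -/
theorem Int.exists_two_pow_dvd_sq_sub (m : ℤ) (k : ℕ) :
    ∃ x : ℤ, Odd x ∧ (2 : ℤ) ^ (k + 3) ∣ x ^ 2 - (8 * m + 1) := by
  induction k with
  | zero => exact ⟨1, odd_one, -m, by ring⟩
  | succ k ih =>
    obtain ⟨x, ⟨y, rfl⟩, c, hc⟩ := ih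
    refine ⟨2 * y + 1 + 2 ^ (k + 2) * c, ⟨y + 2 ^ (k + 1) * c, by ring⟩,
      c * (y + 1) + 2 ^ k * c ^ 2, ?_⟩
    linear_combination hc

/-- If an odd number of integers prime to `p` have a square product, then one of them is a
quadratic residue modulo `p`. -/
theorem exists_legendreSym_eq_one_of_prod_eq_sq {ι : Type*} (p : ℕ) [Fact p.Prime]
    (a : ι → ℤ) (T : Finset ι) (hT : Odd T.card) {k : ℤ} (hk : ∏ j ∈ T, a j = k ^ 2)
    (hp : ∀ j ∈ T, ¬ (p : ℤ) ∣ a j) : ∃ j ∈ T, legendreSym p (a j) = 1 := by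
  by_contra! hne
  have hz : ∀ j ∈ T, (a j : ZMod p) ≠ 0 := fun j hj h ↦
    hp j hj ((ZMod.intCast_zmod_eq_zero_iff_dvd _ _).1 h)
  have hneg : ∀ j ∈ T, legendreSym p (a j) = -1 := fun j hj ↦
    (legendreSym.eq_one_or_neg_one p (hz j hj)).resolve_left (hne j hj)
  have hprod : legendreSym p (∏ j ∈ T, a j) = -1 := by
    have : legendreSym p (∏ j ∈ T, a j) = ∏ j ∈ T, legendreSym p (a j) :=
      map_prod (legendreSym.hom p) a T
    rw [this, Finset.prod_congr rfl hneg, Finset.prod_const, hT.neg_one_pow]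
  rw [hk, sq, legendreSym.mul] at hprod
  nlinarith [mul_self_nonneg (legendreSym p k)]


/-- Sufficiency direction of Theorem 1: under conditions (1) and (2), the polynomial
`f(x) = ∏ i, (x² - a i)` has a root modulo every positive integer. -/
theorem stmt_1 (n : ℕ) (hn : 3 ≤ n) (a : Fin n → ℤ)
    (hinj : Function.Injective a)
    (hne0 : ∀ i, a i ≠ 0) (hsf : ∀ i, Squarefree (a i)) (hne1 : ∀ i, a i ≠ 1)
    (h1 : ∃ T : Finset (Fin n), Odd T.card ∧
        (∃ k : ℤ, ∏ j ∈ T, a j = k ^ 2) ∧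
        (∀ j ∈ T, ∀ p : ℕ, ∀ hp : p.Prime, p ≠ 2 → (p : ℤ) ∣ a j →
          ∃ i : Fin n, i ≠ j ∧ @legendreSym p ⟨hp⟩ (a i) = 1))
    (h2 : ∃ i : Fin n, ∃ m : ℤ, m ≠ 0 ∧ a i = 8 * m + 1) :
    ∀ m : ℕ, 0 < m → ∃ x : ℤ, (m : ℤ) ∣ ∏ i, (x ^ 2 - a i) := by
  obtain ⟨T, hT, ⟨k, hk⟩, hTp⟩ := h1
  have lift_dvd : ∀ (d x : ℤ) (i : Fin n), d ∣ x ^ 2 - a i → d ∣ ∏ i, (x ^ 2 - a i) :=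
    fun d x i h ↦ h.trans (Finset.dvd_prod_of_mem (fun i ↦ x ^ 2 - a i) (Finset.mem_univ i))
  have eval_eq : ∀ x : ℤ, (∏ i, (Polynomial.X ^ 2 - Polynomial.C (a i))).eval x
      = ∏ i, (x ^ 2 - a i) := fun x ↦ by simp [Polynomial.eval_prod]
  simp only [← eval_eq]
  refine Polynomial.exists_dvd_eval_of_prime_pow _ fun p e hp ↦ ?_
  simp only [eval_eq, Nat.cast_pow]
  rcases eq_or_ne p 2 with rfl | hp2
  · obtain ⟨i, m, -, hi⟩ := h2
    obtain ⟨x, -, hx⟩ := Int.exists_two_pow_dvd_sq_sub m e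
    exact ⟨x, lift_dvd _ x i (hi ▸ (pow_dvd_pow _ (by omega)).trans hx)⟩
  · have : Fact p.Prime := ⟨hp⟩
    obtain ⟨i, hi⟩ : ∃ i, legendreSym p (a i) = 1 := by
      by_cases h : ∃ j ∈ T, (p : ℤ) ∣ a j
      · obtain ⟨j, hj, hpj⟩ := h
        obtain ⟨i, -, hi⟩ := hTp j hj p hp hp2 hpj
        exact ⟨i, hi⟩
      · push Not at h
        obtain ⟨j, -, hj⟩ := exists_legendreSym_eq_one_of_prod_eq_sq p a T hT hk h
        exact ⟨j, hj⟩
    have hz : (a i : ZMod p) ≠ 0 := fun h ↦ by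
      rw [(legendreSym.eq_zero_iff p (a i)).2 h] at hi
      exact zero_ne_one hi
    obtain ⟨r, hr⟩ := (legendreSym.eq_one_iff p hz).1 hi
    obtain ⟨x₀, rfl⟩ := ZMod.intCast_surjective r
    have hx₀ : (p : ℤ) ∣ x₀ ^ 2 - a i := by
      rw [← ZMod.intCast_zmod_eq_zero_iff_dvd]
      push_cast
      rw [hr]
      ring
    obtain ⟨x, hx⟩ := Int.exists_pow_dvd_sq_sub_of_odd_prime hp hp2
      (fun h ↦ hz ((ZMod.intCast_zmod_eq_zero_iff_dvd _ _).2 h)) hx₀ e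
    exact ⟨x, lift_dvd _ x i ((pow_dvd_pow _ e.le_succ).trans hx)⟩
end

section
/- Let a₁, a₂, …, aₙ be finitely many nonzero integers. Then the following are equivalent: (1) for every prime p that does not divide the product a₁a₂⋯aₙ, at least one of the aᵢ is a square modulo p; (2) there exists a subset T ⊆ {1, …, n} of odd cardinality such that the product ∏_{j∈T} aⱼ is a perfect square. -/
open NumberTheorySymbols

/-- A nonzero integer that is not a square is minus a square, or has a prime dividing it to an
odd power once a square factor is removed. -/
lemma Int.eq_neg_sq_or_exists_eq_sq_mul_prime_mul {a : ℤ} (ha : ¬ IsSquare a) :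
    (∃ m : ℤ, a = -m ^ 2) ∨
      ∃ (m c : ℤ) (q : ℕ), q.Prime ∧ a = m ^ 2 * (q * c) ∧ ¬ (q : ℤ) ∣ c := by
  obtain ⟨s, m, hsm, hs⟩ := Nat.sq_mul_squarefree a.natAbs
  by_cases hs1 : s = 1
  · left
    subst hs1
    refine ⟨m, ?_⟩
    rcases Int.natAbs_eq a with h | h
    · exact absurd ⟨(m : ℤ), by rw [h, ← hsm]; push_cast; ring⟩ ha
    · rw [h, ← hsm]; push_cast; ring
  · right
    obtain ⟨q, hq, t, rfl⟩ := Nat.exists_prime_and_dvd hs1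
    have hqt : ¬ q ∣ t := fun h =>
      hq.one_lt.ne' (Nat.isUnit_iff.mp (hs q (Nat.mul_dvd_mul_left q h)))
    rcases Int.natAbs_eq a with h | h
    · exact ⟨m, t, q, hq, by rw [h, ← hsm]; push_cast; ring, by exact_mod_cast hqt⟩
    · exact ⟨m, -t, q, hq, by rw [h, ← hsm]; push_cast; ring,
        by rw [dvd_neg]; exact_mod_cast hqt⟩

lemma jacobiSym_sq_mul {m : ℤ} {b : ℕ} (x : ℤ) (h : m.gcd b = 1) : J(m ^ 2 * x | b) = J(x | b) := by
  rw [jacobiSym.mul_left, jacobiSym.sq_one' h, one_mul]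

lemma jacobiSym_eq_one_of_modEq_one {c : ℤ} {b : ℕ} (hb : b ≡ 1 [MOD 4 * c.natAbs]) :
    J(c | b) = 1 := by
  have hodd : Odd b := by
    have : b ≡ 1 [MOD 2] := hb.of_dvd ⟨2 * c.natAbs, by ring⟩
    exact Nat.odd_iff.mpr this
  rw [jacobiSym.mod_right c hodd, hb, ← jacobiSym.mod_right c odd_one, jacobiSym.one_right]

lemma jacobiSym_eq_one_of_odd {c : ℤ} {b : ℕ} (hc : Odd c) (hb4 : b % 4 = 1)
    (hb : b ≡ 1 [MOD c.natAbs]) : J(c | b) = 1 := by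
  have hodd : Odd b := Nat.odd_iff.mpr (by omega)
  have key : J((c.natAbs : ℤ) | b) = 1 := by
    rw [jacobiSym.quadratic_reciprocity_one_mod_four' (Int.natAbs_odd.mpr hc) hb4,
      jacobiSym.mod_left' (a₂ := 1) (by exact_mod_cast hb), jacobiSym.one_left]
  rcases Int.natAbs_eq c with h | h
  · rw [h]; exact key
  · rw [h, jacobiSym.neg _ hodd, key, ZMod.χ₄_nat_one_mod_four hb4, one_mul]

lemma exists_coprime_jacobiSym_prime_mul_eq_neg_one {q : ℕ} (hq : q.Prime) {c : ℤ}
    (hqc : ¬ (q : ℤ) ∣ c) {N : ℕ} (hN : N ≠ 0) (h : 4 * c.natAbs ∣ N) :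
    ∃ b : ℕ, b.Coprime N ∧ J(q * c | b) = -1 := by
  obtain ⟨e, M, hqM, rfl⟩ := Nat.exists_eq_pow_mul_and_not_dvd hN q hq.one_lt.ne'
  have hcq : c.natAbs.Coprime q :=
    ((Nat.Prime.coprime_iff_not_dvd hq).mpr fun h' => hqc (Int.natCast_dvd.mpr h')).symm
  have hMq : q.Coprime M := (Nat.Prime.coprime_iff_not_dvd hq).mpr hqM
  rcases hq.eq_two_or_odd' with rfl | hodd
  · have hcM : c.natAbs ∣ M :=
      (hcq.pow_right e).dvd_of_dvd_mul_left ((Dvd.intro_left _ rfl).trans h)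
    have h8 : Nat.Coprime 8 M := by simpa using hMq.pow_left 3
    obtain ⟨b, hb5, hb1⟩ := Nat.chineseRemainder h8 5 1
    have hb8 : b % 8 = 5 := hb5
    have hbodd : Odd b := Nat.odd_iff.mpr (by omega)
    refine ⟨b, Nat.Coprime.mul_right ?_ ?_, ?_⟩
    · exact (Nat.coprime_two_right.mpr hbodd).pow_right e
    · simpa [Nat.Coprime] using hb1.gcd_eq
    · rw [jacobiSym.mul_left, jacobiSym_eq_one_of_odd _ (by omega) (hb1.of_dvd hcM), mul_one,
        Nat.cast_ofNat, jacobiSym.at_two hbodd, ZMod.χ₈_nat_eq_if_mod_eight]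
      · have : b % 2 = 1 := by omega
        simp [hb8, this]
      · exact Int.not_even_iff_odd.mp fun h' => hqc (by exact_mod_cast h'.two_dvd)
  · have h4q : (4 * c.natAbs).Coprime q := by
      have h2 : Nat.Coprime 2 q := Nat.coprime_two_left.mpr hodd
      exact Nat.Coprime.mul_left (by simpa using h2.pow_left 2) hcq
    have hcM : 4 * c.natAbs ∣ M := (h4q.pow_right e).dvd_of_dvd_mul_left h
    have : Fact q.Prime := ⟨hq⟩
    obtain ⟨r, hr⟩ := FiniteField.exists_nonsquare (F := ZMod q)
      (by rw [ZMod.ringChar_zmod_n]; rintro rfl; exact absurd hodd (by decide))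
    obtain ⟨b, hbr, hb1⟩ := Nat.chineseRemainder hMq r.val 1
    have hbr' : (b : ZMod q) = r := by
      rw [(ZMod.natCast_eq_natCast_iff _ _ _).mpr hbr, ZMod.natCast_zmod_val]
    have hb4 : b % 4 = 1 := hb1.of_dvd ((Dvd.intro _ rfl).trans hcM)
    refine ⟨b, Nat.Coprime.mul_right ?_ ?_, ?_⟩
    · refine ((Nat.Prime.coprime_iff_not_dvd hq).mpr fun h' => hr ?_).symm.pow_right e
      rw [← hbr', (ZMod.natCast_eq_zero_iff _ _).mpr h']
      exact IsSquare.zero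
    · simpa [Nat.Coprime] using hb1.gcd_eq
    · rw [jacobiSym.mul_left, jacobiSym_eq_one_of_modEq_one (hb1.of_dvd hcM), mul_one,
        jacobiSym.quadratic_reciprocity_one_mod_four' hodd hb4,
        ZMod.nonsquare_iff_jacobiSym_eq_neg_one]
      simpa [hbr'] using hr

lemma exists_coprime_jacobiSym_eq_neg_one {a : ℤ} (ha : ¬ IsSquare a) {N : ℕ} (hN : N ≠ 0)
    (h : 4 * a.natAbs ∣ N) : ∃ b : ℕ, b.Coprime N ∧ J(a | b) = -1 := by
  have hgcd {m x : ℤ} {b : ℕ} (hm : a = m ^ 2 * x) (hb : b.Coprime N) : m.gcd b = 1 := by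
    refine (hb.symm.coprime_dvd_left (Dvd.dvd.trans ?_ h) : m.natAbs.Coprime b)
    exact ((Int.natAbs_dvd_natAbs.mpr ⟨m * x, by rw [hm]; ring⟩).trans (Dvd.intro_left _ rfl))
  rcases Int.eq_neg_sq_or_exists_eq_sq_mul_prime_mul ha with ⟨m, hm⟩ | ⟨m, c, q, hq, hm, hqc⟩
  · have h4 : 4 ∣ N := (Dvd.intro _ rfl).trans h
    have hb : (N - 1).Coprime N :=
      (Nat.coprime_self_sub_left (by omega)).mpr (Nat.coprime_one_left N)
    have hm' : a = m ^ 2 * (-1) := by rw [hm]; ring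
    refine ⟨N - 1, hb, ?_⟩
    rw [hm', jacobiSym_sq_mul _ (hgcd hm' hb),
      jacobiSym.at_neg_one (Nat.odd_iff.mpr (by omega)), ZMod.χ₄_nat_three_mod_four (by omega)]
  · have hc : 4 * c.natAbs ∣ N :=
      (Nat.mul_dvd_mul_left 4 (Int.natAbs_dvd_natAbs.mpr ⟨m ^ 2 * q, by rw [hm]; ring⟩)).trans h
    obtain ⟨b, hb, hJ⟩ := exists_coprime_jacobiSym_prime_mul_eq_neg_one hq hqc hN hc
    refine ⟨b, hb, ?_⟩
    rw [hm, jacobiSym_sq_mul _ (hgcd hm hb), hJ]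

lemma jacobiSym_eq_of_modEq {a : ℤ} {N b c : ℕ} (h : 4 * a.natAbs ∣ N) (hb : b.Coprime N)
    (hbc : b ≡ c [MOD N]) : J(a | b) = J(a | c) := by
  have h2 : 2 ∣ N := (Dvd.intro (2 * a.natAbs) (by ring)).trans h
  have hbodd : Odd b := Nat.coprime_two_right.mp (hb.coprime_dvd_right h2)
  have hcodd : Odd c := by
    rw [Nat.odd_iff] at hbodd ⊢
    exact (show c % 2 = b % 2 from (hbc.of_dvd h2).symm).trans hbodd
  rw [jacobiSym.mod_right a hbodd, jacobiSym.mod_right a hcodd, hbc.of_dvd h]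

/-- The Jacobi symbol `J(a | ·)` as a character of the units modulo a multiple of `4 * |a|`. -/
def jacobiUnitsHom (a : ℤ) (N : ℕ) [NeZero N] (h : 4 * a.natAbs ∣ N) : (ZMod N)ˣ →* ℤ where
  toFun u := J(a | (u : ZMod N).val)
  map_one' := by
    have h1 : ((1 : (ZMod N)ˣ) : ZMod N).val ≡ 1 [MOD N] := by
      rw [← ZMod.natCast_eq_natCast_iff]; simp
    rw [jacobiSym_eq_of_modEq h (ZMod.val_coe_unit_coprime _) h1, jacobiSym.one_right]
  map_mul' u v := by
    have hN : 2 ≤ N := by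
      have := Nat.pos_of_ne_zero (NeZero.ne N)
      have h4 : 4 ∣ N := (Dvd.intro _ rfl).trans h
      omega
    have hne (w : (ZMod N)ˣ) : (w : ZMod N).val ≠ 0 := fun h0 => by
      have := ZMod.val_coe_unit_coprime w
      rw [h0, Nat.coprime_zero_left] at this
      omega
    have h1 : ((u * v : (ZMod N)ˣ) : ZMod N).val ≡ (u : ZMod N).val * (v : ZMod N).val [MOD N] := by
      rw [← ZMod.natCast_eq_natCast_iff]; simp
    rw [jacobiSym_eq_of_modEq h (ZMod.val_coe_unit_coprime _) h1,
      jacobiSym.mul_right' a (hne u) (hne v)]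

lemma sum_jacobiSym_units_eq_zero {a : ℤ} (ha : ¬ IsSquare a) {N : ℕ} [NeZero N]
    (h : 4 * a.natAbs ∣ N) : ∑ u : (ZMod N)ˣ, J(a | (u : ZMod N).val) = 0 := by
  refine sum_hom_units_eq_zero (jacobiUnitsHom a N h) fun h1 => ?_
  obtain ⟨b, hb, hJ⟩ := exists_coprime_jacobiSym_eq_neg_one ha (NeZero.ne N) h
  have h2 : J(a | ((ZMod.unitOfCoprime b hb : (ZMod N)ˣ) : ZMod N).val) = 1 :=
    DFunLike.congr_fun h1 (ZMod.unitOfCoprime b hb)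
  have h3 : ((ZMod.unitOfCoprime b hb : (ZMod N)ˣ) : ZMod N).val ≡ b [MOD N] := by
    rw [← ZMod.natCast_eq_natCast_iff]; simp
  rw [jacobiSym_eq_of_modEq h (ZMod.val_coe_unit_coprime _) h3, hJ] at h2
  norm_num at h2

lemma sum_jacobiSym_units_nonneg (a : ℤ) {N : ℕ} [NeZero N] (h : 4 * a.natAbs ∣ N) :
    0 ≤ ∑ u : (ZMod N)ˣ, J(a | (u : ZMod N).val) := by
  by_cases h1 : jacobiUnitsHom a N h = 1
  · refine Finset.sum_nonneg fun u _ => ?_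
    have h2 : J(a | (u : ZMod N).val) = 1 := DFunLike.congr_fun h1 u
    rw [h2]; exact zero_le_one
  · exact (sum_hom_units_eq_zero (jacobiUnitsHom a N h) h1).ge

lemma jacobiSym_prod_left {ι : Type*} (s : Finset ι) (a : ι → ℤ) (b : ℕ) :
    J(∏ i ∈ s, a i | b) = ∏ i ∈ s, J(a i | b) := by
  classical
  induction s using Finset.induction_on with
  | empty => simp [jacobiSym.one_left]
  | insert i s hi ih => rw [Finset.prod_insert hi, Finset.prod_insert hi, jacobiSym.mul_left, ih]

/-- If no product of an odd number of the `a i` is a square, then some residue class makes all the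
Jacobi symbols `J(a i | ·)` equal to `-1`. -/
lemma exists_unit_forall_jacobiSym_eq_neg_one {ι : Type*} [Fintype ι] (a : ι → ℤ)
    (hsq : ∀ T : Finset ι, Odd T.card → ¬ IsSquare (∏ j ∈ T, a j)) {N : ℕ} [NeZero N]
    (h : 4 * (∏ i, a i).natAbs ∣ N) :
    ∃ u : (ZMod N)ˣ, ∀ i, J(a i | (u : ZMod N).val) = -1 := by
  have hdvd (T : Finset ι) : 4 * (∏ j ∈ T, a j).natAbs ∣ N :=
    (Nat.mul_dvd_mul_left 4 (Int.natAbs_dvd_natAbs.mpr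
      (Finset.prod_dvd_prod_of_subset _ _ a (Finset.subset_univ T)))).trans h
  have hexpand : ∑ u : (ZMod N)ˣ, ∏ i, (1 + -J(a i | (u : ZMod N).val)) =
      ∑ T : Finset ι, (-1) ^ T.card * ∑ u : (ZMod N)ˣ, J(∏ j ∈ T, a j | (u : ZMod N).val) := by
    simp_rw [Finset.prod_one_add, Finset.prod_neg, Finset.powerset_univ, jacobiSym_prod_left,
      Finset.mul_sum]
    exact Finset.sum_comm
  have hpos : 0 < ∑ u : (ZMod N)ˣ, ∏ i, (1 + -J(a i | (u : ZMod N).val)) := by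
    rw [hexpand]
    refine Finset.sum_pos' (fun T _ => ?_) ⟨∅, Finset.mem_univ _, ?_⟩
    · rcases Nat.even_or_odd T.card with hT | hT
      · rw [hT.neg_one_pow, one_mul]
        exact sum_jacobiSym_units_nonneg _ (hdvd T)
      · rw [sum_jacobiSym_units_eq_zero (hsq T hT) (hdvd T), mul_zero]
    · simp [jacobiSym.one_left, Nat.pos_of_ne_zero (NeZero.ne N)]
  obtain ⟨u, -, hu⟩ := Finset.exists_ne_zero_of_sum_ne_zero hpos.ne'
  refine ⟨u, fun i => ?_⟩
  have hi := Finset.prod_ne_zero_iff.mp hu i (Finset.mem_univ i)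
  have hco : (a i).gcd ((u : ZMod N).val : ℕ) = 1 := by
    refine ((ZMod.val_coe_unit_coprime u).symm.coprime_dvd_left ?_ :
      (a i).natAbs.Coprime (u : ZMod N).val)
    have := hdvd {i}
    rw [Finset.prod_singleton] at this
    exact (Dvd.intro_left _ rfl).trans this
  rcases jacobiSym.eq_one_or_neg_one hco with h1 | h1
  · exact absurd (by rw [h1]; rfl) hi
  · exact h1

/-- If all the Jacobi symbols `J(a i | p)` are `-1`, no product of oddly many `a i` is a square. -/
lemma not_isSquare_prod_of_jacobiSym {ι : Type*} {a : ι → ℤ} {p : ℕ}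
    (h : ∀ i, J(a i | p) = -1) {T : Finset ι} (hT : Odd T.card) : ¬ IsSquare (∏ j ∈ T, a j) := by
  rintro ⟨k, hk⟩
  have h1 : J(∏ j ∈ T, a j | p) = -1 := by
    simp [jacobiSym_prod_left, h, hT.neg_one_pow]
  rw [hk, jacobiSym.mul_left] at h1
  nlinarith [mul_self_nonneg J(k | p)]

lemma isSquare_zmod_iff_exists_dvd {p : ℕ} {a : ℤ} :
    IsSquare (a : ZMod p) ↔ ∃ x : ℤ, (p : ℤ) ∣ x ^ 2 - a := by
  constructor
  · rintro ⟨y, hy⟩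
    obtain ⟨x, rfl⟩ := ZMod.intCast_surjective y
    refine ⟨x, (ZMod.intCast_zmod_eq_zero_iff_dvd _ p).mp ?_⟩
    push_cast
    rw [hy]; ring
  · rintro ⟨x, hx⟩
    have := (ZMod.intCast_zmod_eq_zero_iff_dvd _ p).mpr hx
    push_cast at this
    exact ⟨x, by rw [← pow_two, sub_eq_zero.mp this]⟩

/-- **Lemma 1.** For finitely many nonzero integers `a 1, …, a n`, the following are
equivalent: (1) for each prime `p` not dividing `∏ i, a i`, some `a i` is a square
modulo `p`; (2) there is a subset `T` of odd cardinality with `∏_{j ∈ T} a j` a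
perfect square. -/
theorem stmt_4 (n : ℕ) (a : Fin n → ℤ) (hne0 : ∀ i, a i ≠ 0) :
    (∀ p : ℕ, p.Prime → ¬ (p : ℤ) ∣ ∏ i, a i →
        ∃ i : Fin n, ∃ x : ℤ, (p : ℤ) ∣ x ^ 2 - a i) ↔
      (∃ T : Finset (Fin n), Odd T.card ∧ ∃ k : ℤ, ∏ j ∈ T, a j = k ^ 2) := by
  constructor
  · intro h
    by_contra! hno
    have hsq (T : Finset (Fin n)) (hT : Odd T.card) : ¬ IsSquare (∏ j ∈ T, a j) :=
      fun ⟨k, hk⟩ => hno T hT k (by rw [hk, pow_two])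
    have hprod : ∏ i, a i ≠ 0 := Finset.prod_ne_zero_iff.mpr fun i _ => hne0 i
    have : NeZero (4 * (∏ i, a i).natAbs) :=
      ⟨mul_ne_zero (by norm_num) (Int.natAbs_ne_zero.mpr hprod)⟩
    obtain ⟨u, hu⟩ := exists_unit_forall_jacobiSym_eq_neg_one a hsq dvd_rfl
    obtain ⟨p, -, hp, hpu⟩ := Nat.forall_exists_prime_gt_and_eq_mod u.isUnit 0
    have hmod : (u : ZMod (4 * (∏ i, a i).natAbs)).val ≡ p
        [MOD 4 * (∏ i, a i).natAbs] := by
      rw [← ZMod.natCast_eq_natCast_iff, ZMod.natCast_zmod_val, hpu]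
    have hpN : p.Coprime (4 * (∏ i, a i).natAbs) := by
      rw [← ZMod.isUnit_iff_coprime, hpu]
      exact u.isUnit
    have hpd : ¬ (p : ℤ) ∣ ∏ i, a i := fun hd =>
      (Nat.Prime.coprime_iff_not_dvd hp).mp hpN
        ((Int.natCast_dvd.mp hd).trans (Dvd.intro_left _ rfl))
    obtain ⟨i, hi⟩ := h p hp hpd
    have : Fact p.Prime := ⟨hp⟩
    refine ZMod.nonsquare_iff_jacobiSym_eq_neg_one.mp ?_ (isSquare_zmod_iff_exists_dvd.mpr hi)
    rw [← hu i]
    refine (jacobiSym_eq_of_modEq ?_ (ZMod.val_coe_unit_coprime u) hmod).symm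
    exact Nat.mul_dvd_mul_left 4
      (Int.natAbs_dvd_natAbs.mpr (Finset.dvd_prod_of_mem a (Finset.mem_univ i)))
  · rintro ⟨T, hT, k, hk⟩ p hp -
    by_contra! hno
    have : Fact p.Prime := ⟨hp⟩
    refine not_isSquare_prod_of_jacobiSym (a := a) (p := p) (fun i => ?_) hT
      ⟨k, by rw [hk, pow_two]⟩
    rw [ZMod.nonsquare_iff_jacobiSym_eq_neg_one, isSquare_zmod_iff_exists_dvd]
    exact fun ⟨x, hx⟩ => hno i x hx
end

section
/- The polynomial f(x) = (x² − 13)(x² − 17)(x² − 221) has a root modulo every positive integer but has no rational root. -/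
open Polynomial in
theorem exists_dvd_eval_of_forall_prime_pow (f : ℤ[X])
    (h : ∀ p : ℕ, p.Prime → ∀ n : ℕ, ∃ x : ℤ, (p : ℤ) ^ n ∣ f.eval x) (m : ℕ) (hm : 0 < m) :
    ∃ x : ℤ, (m : ℤ) ∣ f.eval x := by
  induction m using Nat.recOnPosPrimePosCoprime with
  | zero => simp at hm
  | one => exact ⟨0, by simp⟩
  | prime_pow p n hp hn => simpa using h p hp n
  | coprime a b ha hb hab iha ihb =>
    obtain ⟨x, hx⟩ := iha (by omega)
    obtain ⟨y, hy⟩ := ihb (by omega)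
    have hab' : IsCoprime (a : ℤ) b := Nat.isCoprime_iff_coprime.mpr hab
    obtain ⟨u, v, huv⟩ := id hab'
    refine ⟨x * (v * b) + y * (u * a), ?_⟩
    push_cast
    refine hab'.mul_dvd ?_ ?_
    · refine (dvd_iff_dvd_of_dvd_sub (dvd_trans ?_ (f.sub_dvd_eval_sub _ x))).mpr hx
      exact ⟨u * (y - x), by linear_combination x * huv⟩
    · refine (dvd_iff_dvd_of_dvd_sub (dvd_trans ?_ (f.sub_dvd_eval_sub _ y))).mpr hy
      exact ⟨v * (x - y), by linear_combination y * huv⟩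

theorem exists_pow_dvd_sq_sub {p a x₀ : ℤ} (hx₀ : p ∣ x₀ ^ 2 - a) (hc : IsCoprime (2 * x₀) p)
    (n : ℕ) : ∃ x : ℤ, p ^ n ∣ x ^ 2 - a := by
  suffices H : ∃ x : ℤ, IsCoprime (2 * x) p ∧ p ^ (n + 1) ∣ x ^ 2 - a by
    obtain ⟨x, -, hx⟩ := H
    exact ⟨x, (pow_dvd_pow p n.le_succ).trans hx⟩
  induction n with
  | zero => exact ⟨x₀, hc, by simpa using hx₀⟩
  | succ n ih =>
    obtain ⟨x, hx, k, hk⟩ := ih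
    obtain ⟨u, v, huv⟩ := id hx
    refine ⟨x + p ^ (n + 1) * (-k * u), ?_, k * v + p ^ n * (k * u) ^ 2, ?_⟩
    · have h : 2 * (x + p ^ (n + 1) * (-k * u)) = 2 * x + p * (2 * p ^ n * (-k * u)) := by ring
      rw [h]
      exact hx.add_mul_left_left _
    · linear_combination hk - p ^ (n + 1) * k * huv

theorem exists_two_pow_dvd_sq_sub {a : ℤ} (ha : 8 ∣ 1 - a) (n : ℕ) :
    ∃ x : ℤ, 2 ^ n ∣ x ^ 2 - a := by
  suffices H : ∃ x : ℤ, Odd x ∧ 2 ^ (n + 3) ∣ x ^ 2 - a by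
    obtain ⟨x, -, hx⟩ := H
    exact ⟨x, (pow_dvd_pow 2 (by omega)).trans hx⟩
  induction n with
  | zero => exact ⟨1, odd_one, by simpa using ha⟩
  | succ n ih =>
    obtain ⟨x, ⟨y, rfl⟩, k, hk⟩ := ih
    refine ⟨2 * y + 1 + 2 ^ (n + 2) * k, ⟨y + 2 ^ (n + 1) * k, by ring⟩,
      k * (y + 1) + 2 ^ n * k ^ 2, ?_⟩
    linear_combination hk

theorem exists_prime_pow_dvd_sq_sub_of_isSquare {p : ℕ} (hp : p.Prime) (hp2 : p ≠ 2) {a : ℤ}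
    (ha₀ : (a : ZMod p) ≠ 0) (ha : IsSquare (a : ZMod p)) (n : ℕ) :
    ∃ x : ℤ, (p : ℤ) ^ n ∣ x ^ 2 - a := by
  have := Fact.mk hp
  obtain ⟨z, hz⟩ := ha
  obtain ⟨x, rfl⟩ := ZMod.intCast_surjective z
  refine exists_pow_dvd_sq_sub (x₀ := x) ?_ ?_ n
  · rw [← ZMod.intCast_zmod_eq_zero_iff_dvd]
    push_cast
    rw [hz]
    ring
  · refine ((Nat.prime_iff_prime_int.mp hp).coprime_iff_not_dvd.mpr fun hd => ?_).symm
    rcases (Nat.prime_iff_prime_int.mp hp).dvd_or_dvd hd with h | h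
    · exact hp2 ((Nat.prime_dvd_prime_iff_eq hp Nat.prime_two).mp (by exact_mod_cast h))
    · rw [← ZMod.intCast_zmod_eq_zero_iff_dvd] at h
      exact ha₀ (by rw [hz, h, mul_zero])

theorem isSquare_or_isSquare_or_isSquare_mul {p : ℕ} [Fact p.Prime] {a b : ℤ}
    (ha : (a : ZMod p) ≠ 0) (hb : (b : ZMod p) ≠ 0) :
    IsSquare (a : ZMod p) ∨ IsSquare (b : ZMod p) ∨ IsSquare ((a * b : ℤ) : ZMod p) := by
  have hab : ((a * b : ℤ) : ZMod p) ≠ 0 := by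
    push_cast
    exact mul_ne_zero ha hb
  rw [← legendreSym.eq_one_iff p ha, ← legendreSym.eq_one_iff p hb,
    ← legendreSym.eq_one_iff p hab, legendreSym.mul]
  rcases legendreSym.eq_one_or_neg_one p ha with h | h <;>
    rcases legendreSym.eq_one_or_neg_one p hb with h' | h' <;> simp [h, h']

theorem exists_prime_pow_dvd_sq_sub_thirteen_or_seventeen_or_mul {p : ℕ} (hp : p.Prime) (n : ℕ) :
    ∃ x : ℤ, (p : ℤ) ^ n ∣ x ^ 2 - 13 ∨ (p : ℤ) ^ n ∣ x ^ 2 - 17 ∨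
      (p : ℤ) ^ n ∣ x ^ 2 - 221 := by
  by_cases h2 : p = 2
  · subst h2
    obtain ⟨x, hx⟩ := exists_two_pow_dvd_sq_sub (a := 17) (by norm_num) n
    exact ⟨x, .inr (.inl hx)⟩
  by_cases h13 : p = 13
  · subst h13
    obtain ⟨x, hx⟩ := exists_pow_dvd_sq_sub (p := 13) (a := 17) (x₀ := 2) (by norm_num)
      ⟨-3, 1, by norm_num⟩ n
    exact ⟨x, .inr (.inl hx)⟩
  by_cases h17 : p = 17
  · subst h17
    obtain ⟨x, hx⟩ := exists_pow_dvd_sq_sub (p := 17) (a := 13) (x₀ := 8) (by norm_num)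
      ⟨-1, 1, by norm_num⟩ n
    exact ⟨x, .inl hx⟩
  have := Fact.mk hp
  have ha : ((13 : ℤ) : ZMod p) ≠ 0 := fun h => h13 <| by
    rw [ZMod.intCast_zmod_eq_zero_iff_dvd] at h
    exact (Nat.prime_dvd_prime_iff_eq hp (by norm_num)).mp (by exact_mod_cast h)
  have hb : ((17 : ℤ) : ZMod p) ≠ 0 := fun h => h17 <| by
    rw [ZMod.intCast_zmod_eq_zero_iff_dvd] at h
    exact (Nat.prime_dvd_prime_iff_eq hp (by norm_num)).mp (by exact_mod_cast h)
  have hab : ((13 * 17 : ℤ) : ZMod p) ≠ 0 := by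
    rw [Int.cast_mul]
    exact mul_ne_zero ha hb
  rcases isSquare_or_isSquare_or_isSquare_mul ha hb with h | h | h
  · obtain ⟨x, hx⟩ := exists_prime_pow_dvd_sq_sub_of_isSquare hp h2 ha h n
    exact ⟨x, .inl hx⟩
  · obtain ⟨x, hx⟩ := exists_prime_pow_dvd_sq_sub_of_isSquare hp h2 hb h n
    exact ⟨x, .inr (.inl hx)⟩
  · obtain ⟨x, hx⟩ := exists_prime_pow_dvd_sq_sub_of_isSquare hp h2 hab h n
    exact ⟨x, .inr (.inr (by simpa using hx))⟩

theorem Rat.sq_sub_natCast_ne_zero {n : ℕ} (hn : ¬ IsSquare n) (r : ℚ) : r ^ 2 - n ≠ 0 :=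
  fun h => hn (Rat.isSquare_natCast_iff.mp ⟨r, by linear_combination -h⟩)

/-- `f(x) = (x² - 13)(x² - 17)(x² - 221)` has a root modulo every positive integer
but no rational root. -/
theorem stmt_13 :
    (∀ m : ℕ, 0 < m → ∃ x : ℤ,
        (m : ℤ) ∣ (x ^ 2 - 13) * (x ^ 2 - 17) * (x ^ 2 - 221)) ∧
      ¬ ∃ r : ℚ, (r ^ 2 - 13) * (r ^ 2 - 17) * (r ^ 2 - 221) = 0 := by
  constructor
  · intro m hm
    open Polynomial in
    have H := exists_dvd_eval_of_forall_prime_pow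
      ((X ^ 2 - C 13) * (X ^ 2 - C 17) * (X ^ 2 - C 221)) ?_ m hm
    · simpa only [Polynomial.eval_mul, Polynomial.eval_sub, Polynomial.eval_pow,
        Polynomial.eval_X, Polynomial.eval_C] using H
    · intro p hp n
      obtain ⟨x, hx⟩ := exists_prime_pow_dvd_sq_sub_thirteen_or_seventeen_or_mul hp n
      refine ⟨x, ?_⟩
      simp only [Polynomial.eval_mul, Polynomial.eval_sub, Polynomial.eval_pow,
        Polynomial.eval_X, Polynomial.eval_C]
      rcases hx with h | h | h
      · exact (h.mul_right _).mul_right _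
      · exact (h.mul_left _).mul_right _
      · exact h.mul_left _
  · rintro ⟨r, hr⟩
    have h13 := Rat.sq_sub_natCast_ne_zero (n := 13) (by norm_num) r
    have h17 := Rat.sq_sub_natCast_ne_zero (n := 17) (by norm_num) r
    have h221 := Rat.sq_sub_natCast_ne_zero (n := 221) (by norm_num) r
    exact mul_ne_zero (mul_ne_zero h13 h17) h221 (by exact_mod_cast hr)
end
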